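/- For every α > 0 there is a constant C_α > 0 such that for all smooth divergence-free vector fields u, V : 𝕋² → ℝ², the H^{0,1}-inner product of the transport terms against V satisfies | ⟨V·∇u, V⟩_{L²} + ⟨∂₂(V·∇u), ∂₂V⟩_{L²} + ⟨u·∇V, V⟩_{L²} + ⟨∂₂(u·∇V), ∂₂V⟩_{L²} | ≤ α ‖V‖²_{H^{1,1}} + C_α (1 + ‖u‖²_{H^{1,2}}) ‖V‖²_{H^{0,1}}. -/

import Mathlib

open MeasureTheory Real Complex Filter Set

noncomputable section

namespace Aniso

/-- Fundamental domain `(0, 2π]` for the circle of circumference `2π`. -/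
def I2pi : Set ℝ := Set.Ioc 0 (2 * π)

/-- Fundamental domain for the 2-torus `𝕋² = (ℝ/2πℤ)²`. -/
def Q2 : Set (ℝ × ℝ) := I2pi ×ˢ I2pi

/-- Integral over the torus of a real function. -/
def tintR (f : ℝ × ℝ → ℝ) : ℝ := ∫ x in Q2, f x

/-- Smoothness of a scalar field. -/
def Smooth (f : ℝ × ℝ → ℝ) : Prop := ContDiff ℝ (⊤ : ℕ∞) f

/-- Smoothness of a vector field. -/
def SmoothV (u : ℝ × ℝ → ℝ × ℝ) : Prop := ContDiff ℝ (⊤ : ℕ∞) u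

/-- `2π`-periodicity in each variable: this encodes being a function on the torus. -/
def Per (f : ℝ × ℝ → ℝ) : Prop :=
  (∀ x : ℝ × ℝ, f (x.1 + 2 * π, x.2) = f x) ∧ (∀ x : ℝ × ℝ, f (x.1, x.2 + 2 * π) = f x)

def PerV (u : ℝ × ℝ → ℝ × ℝ) : Prop :=
  Per (fun x => (u x).1) ∧ Per (fun x => (u x).2)

/-- Partial derivative in the horizontal variable `x₁`. -/
def pd1 (f : ℝ × ℝ → ℝ) : ℝ × ℝ → ℝ := fun x => fderiv ℝ f x (1, 0)

/-- Partial derivative in the vertical variable `x₂`. -/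
def pd2 (f : ℝ × ℝ → ℝ) : ℝ × ℝ → ℝ := fun x => fderiv ℝ f x (0, 1)

def comp1 (u : ℝ × ℝ → ℝ × ℝ) : ℝ × ℝ → ℝ := fun x => (u x).1
def comp2 (u : ℝ × ℝ → ℝ × ℝ) : ℝ × ℝ → ℝ := fun x => (u x).2

def pd1V (u : ℝ × ℝ → ℝ × ℝ) : ℝ × ℝ → ℝ × ℝ := fun x => (pd1 (comp1 u) x, pd1 (comp2 u) x)
def pd2V (u : ℝ × ℝ → ℝ × ℝ) : ℝ × ℝ → ℝ × ℝ := fun x => (pd2 (comp1 u) x, pd2 (comp2 u) x)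

/-- Divergence-free condition `∂₁u¹ + ∂₂u² = 0`. -/
def DivFree (u : ℝ × ℝ → ℝ × ℝ) : Prop :=
  ∀ x, pd1 (comp1 u) x + pd2 (comp2 u) x = 0

/-- The transport term `u·∇v`, with components `u¹∂₁vʲ + u²∂₂vʲ`. -/
def advect (u v : ℝ × ℝ → ℝ × ℝ) : ℝ × ℝ → ℝ × ℝ := fun x =>
  ((u x).1 * pd1 (comp1 v) x + (u x).2 * pd2 (comp1 v) x,
   (u x).1 * pd1 (comp2 v) x + (u x).2 * pd2 (comp2 v) x)

/-- L² inner product of real vector fields on the torus (summed over components). -/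
def ipV (u v : ℝ × ℝ → ℝ × ℝ) : ℝ := tintR fun x => (u x).1 * (v x).1 + (u x).2 * (v x).2

/-- The trilinear form `b(u,v,w) = ∫ (u·∇v)·w`. -/
def b3 (u v w : ℝ × ℝ → ℝ × ℝ) : ℝ := ipV (advect u v) w

/-- L² norm of a scalar function on the torus. -/
def L2 (f : ℝ × ℝ → ℝ) : ℝ := Real.sqrt (tintR fun x => f x ^ 2)

/-- L² norm of a vector field on the torus. -/
def L2V (u : ℝ × ℝ → ℝ × ℝ) : ℝ := Real.sqrt (tintR fun x => (u x).1 ^ 2 + (u x).2 ^ 2)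

/-- Fourier coefficient of a complex-valued function on the torus. -/
def fcC (f : ℝ × ℝ → ℂ) (k : ℤ × ℤ) : ℂ :=
  (1 / (2 * π) ^ 2 : ℂ) *
    ∫ x in Q2, f x * Complex.exp (-(Complex.I) * ((k.1 : ℂ) * (x.1 : ℂ) + (k.2 : ℂ) * (x.2 : ℂ)))

/-- Fourier coefficient of a real-valued function on the torus. -/
def fc (f : ℝ × ℝ → ℝ) (k : ℤ × ℤ) : ℂ := fcC (fun x => (f x : ℂ)) k

/-- Anisotropic Sobolev weight `(1+|k₁|²)^s (1+|k₂|²)^{s'}`. -/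
def aw (s s' : ℝ) (k : ℤ × ℤ) : ℝ :=
  (1 + (k.1 : ℝ) ^ 2) ^ s * (1 + (k.2 : ℝ) ^ 2) ^ s'

/-- Square of the anisotropic Sobolev norm `H^{s,s'}` of a scalar function. -/
def HSq (s s' : ℝ) (f : ℝ × ℝ → ℝ) : ℝ := ∑' k : ℤ × ℤ, aw s s' k * ‖fc f k‖ ^ 2

/-- Anisotropic Sobolev norm `H^{s,s'}` of a scalar function. -/
def HN (s s' : ℝ) (f : ℝ × ℝ → ℝ) : ℝ := Real.sqrt (HSq s s' f)

/-- Anisotropic Sobolev norm `H^{s,s'}` of a vector field. -/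
def HNV (s s' : ℝ) (u : ℝ × ℝ → ℝ × ℝ) : ℝ :=
  Real.sqrt (HSq s s' (comp1 u) + HSq s s' (comp2 u))

/-- Mixed norm `L^∞_h(L²_v)`. -/
def LinfhL2v (f : ℝ × ℝ → ℝ) : ℝ :=
  essSup (fun x1 : ℝ => Real.sqrt (∫ x2 in I2pi, f (x1, x2) ^ 2)) (volume.restrict I2pi)

/-- Mixed norm `L²_h(L^∞_v)`. -/
def L2hLinfv (f : ℝ × ℝ → ℝ) : ℝ :=
  Real.sqrt (∫ x1 in I2pi, (essSup (fun x2 : ℝ => |f (x1, x2)|) (volume.restrict I2pi)) ^ 2)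

/-- Mixed norm `L²_v(L^{4/3}_h)`. -/
def L2vL43h {E : Type*} [NormedAddCommGroup E] (f : ℝ × ℝ → E) : ℝ :=
  Real.sqrt (∫ x2 in I2pi, (∫ x1 in I2pi, ‖f (x1, x2)‖ ^ ((4 : ℝ)/3)) ^ ((3 : ℝ)/2))

/-- Mixed norm `L^∞_v(L²_h)`. -/
def LinfvL2h {E : Type*} [NormedAddCommGroup E] (f : ℝ × ℝ → E) : ℝ :=
  essSup (fun x2 : ℝ => Real.sqrt (∫ x1 in I2pi, ‖f (x1, x2)‖ ^ 2)) (volume.restrict I2pi)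

/-- Mixed norm `L²_v(L⁴_h)`. -/
def L2vL4h {E : Type*} [NormedAddCommGroup E] (f : ℝ × ℝ → E) : ℝ :=
  Real.sqrt (∫ x2 in I2pi, Real.sqrt (∫ x1 in I2pi, ‖f (x1, x2)‖ ^ 4))

/-- One-dimensional Fourier coefficient on the circle of circumference `2π`. -/
def fc1 (g : ℝ → ℂ) (n : ℤ) : ℂ :=
  (1 / (2 * π) : ℂ) * ∫ x in I2pi, g x * Complex.exp (-(Complex.I) * ((n : ℂ) * (x : ℂ)))

/-- Square of the 1-d Sobolev norm `H^s(𝕋)`. -/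
def H1Sq (s : ℝ) (g : ℝ → ℂ) : ℝ := ∑' n : ℤ, (1 + (n : ℝ) ^ 2) ^ s * ‖fc1 g n‖ ^ 2

/-- Mixed norm `L²_v(H^s_h)`. -/
def L2vHsh (s : ℝ) (f : ℝ × ℝ → ℂ) : ℝ :=
  Real.sqrt (∫ x2 in I2pi, H1Sq s (fun x1 => f (x1, x2)))

/-- A dyadic partition of unity `(χ, θ)` on `ℝ`. -/
structure IsDyadicPartition (χ θ : ℝ → ℝ) : Prop where
  smooth_chi : ContDiff ℝ (⊤ : ℕ∞) χ
  smooth_theta : ContDiff ℝ (⊤ : ℕ∞) θ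
  nonneg_chi : ∀ z, 0 ≤ χ z
  nonneg_theta : ∀ z, 0 ≤ θ z
  even_chi : ∀ z, χ (-z) = χ z
  even_theta : ∀ z, θ (-z) = θ z
  chi_support : ∃ R > 0, ∀ z, R ≤ |z| → χ z = 0
  theta_support : ∃ r R : ℝ, 0 < r ∧ r < R ∧ ∀ z, (|z| < r ∨ R < |z|) → θ z = 0
  partition : ∀ z : ℝ, χ z + ∑' j : ℕ, θ ((2 : ℝ) ^ (-(j : ℤ)) * z) = 1
  chi_theta_disj : ∀ j : ℕ, 1 ≤ j → ∀ z, χ z * θ ((2 : ℝ) ^ (-(j : ℤ)) * z) = 0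
  theta_theta_disj : ∀ i j : ℕ, 1 < |(i : ℤ) - (j : ℤ)| → ∀ z,
    θ ((2 : ℝ) ^ (-(i : ℤ)) * z) * θ ((2 : ℝ) ^ (-(j : ℤ)) * z) = 0

/-- The Fourier multiplier symbol of the vertical Littlewood–Paley block `Δ^v_j`. -/
def blockSymb (χ θ : ℝ → ℝ) (j : ℤ) (z : ℝ) : ℝ :=
  if j = -1 then χ |z| else if 0 ≤ j then θ ((2 : ℝ) ^ (-j) * |z|) else 0

/-- The Fourier multiplier symbol of the vertical low-frequency cut-off `S^v_j`. -/
def lowSymb (χ θ : ℝ → ℝ) (j : ℤ) (z : ℝ) : ℝ :=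
  ∑ j' ∈ Finset.Icc (-1 : ℤ) (j - 2), blockSymb χ θ j' z

/-- The character `e^{ik·x}`. -/
def eK (k : ℤ × ℤ) (x : ℝ × ℝ) : ℂ :=
  Complex.exp (Complex.I * ((k.1 : ℂ) * (x.1 : ℂ) + (k.2 : ℂ) * (x.2 : ℂ)))

/-- Vertical Littlewood–Paley block `Δ^v_j` of a complex-valued function. -/
def LPC (χ θ : ℝ → ℝ) (j : ℤ) (f : ℝ × ℝ → ℂ) : ℝ × ℝ → ℂ :=
  fun x => ∑' k : ℤ × ℤ, (blockSymb χ θ j k.2 : ℂ) * fcC f k * eK k x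

/-- Vertical Littlewood–Paley block `Δ^v_j` of a real-valued function. -/
def LP (χ θ : ℝ → ℝ) (j : ℤ) (f : ℝ × ℝ → ℝ) : ℝ × ℝ → ℂ :=
  LPC χ θ j fun x => (f x : ℂ)

/-- Vertical low-frequency cut-off `S^v_j` of a complex-valued function. -/
def SvC (χ θ : ℝ → ℝ) (j : ℤ) (f : ℝ × ℝ → ℂ) : ℝ × ℝ → ℂ :=
  fun x => ∑' k : ℤ × ℤ, (lowSymb χ θ j k.2 : ℂ) * fcC f k * eK k x

/-- Vertical low-frequency cut-off `S^v_j` of a real-valued function. -/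
def Sv (χ θ : ℝ → ℝ) (j : ℤ) (f : ℝ × ℝ → ℝ) : ℝ × ℝ → ℂ :=
  SvC χ θ j fun x => (f x : ℂ)

/-- Componentwise Littlewood–Paley block of a vector field. -/
def LPV (χ θ : ℝ → ℝ) (j : ℤ) (u : ℝ × ℝ → ℝ × ℝ) : ℝ × ℝ → ℂ × ℂ :=
  fun x => (LP χ θ j (comp1 u) x, LP χ θ j (comp2 u) x)

/-- Componentwise low-frequency cut-off of a vector field. -/
def SvV (χ θ : ℝ → ℝ) (j : ℤ) (u : ℝ × ℝ → ℝ × ℝ) : ℝ × ℝ → ℂ × ℂ :=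
  fun x => (Sv χ θ j (comp1 u) x, Sv χ θ j (comp2 u) x)

/-- L² inner product of complex-valued functions on the torus. -/
def ipC (f g : ℝ × ℝ → ℂ) : ℂ := ∫ x in Q2, f x * (starRingEnd ℂ) (g x)

/-- L² inner product of complex vector fields on the torus (summed over components). -/
def ipCV (f g : ℝ × ℝ → ℂ × ℂ) : ℂ :=
  ∫ x in Q2, ((f x).1 * (starRingEnd ℂ) ((g x).1) + (f x).2 * (starRingEnd ℂ) ((g x).2))

/-- The vertical paraproduct `T^v_a g = Σ_j S^v_{j-1}a · Δ^v_j g`. -/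
def Tv (χ θ : ℝ → ℝ) (a g : ℝ × ℝ → ℝ) : ℝ × ℝ → ℂ :=
  fun x => ∑' j : ℤ, Sv χ θ (j - 1) a x * LP χ θ j g x

/-- The vertical remainder `R^v(a,g) = Σ_{|j-j'|≤1} Δ^v_j a · Δ^v_{j'} g`. -/
def Rv (χ θ : ℝ → ℝ) (a g : ℝ × ℝ → ℝ) : ℝ × ℝ → ℂ :=
  fun x => ∑' p : ℤ × ℤ, if |p.1 - p.2| ≤ 1 then LP χ θ p.1 a x * LP χ θ p.2 g x else 0


lemma Smooth.pd1 {f : ℝ × ℝ → ℝ} (hf : Smooth f) : Smooth (pd1 f) :=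
  (hf.fderiv_right (m := (⊤ : ℕ∞)) (by norm_cast)).clm_apply contDiff_const

lemma Smooth.pd2 {f : ℝ × ℝ → ℝ} (hf : Smooth f) : Smooth (pd2 f) :=
  (hf.fderiv_right (m := (⊤ : ℕ∞)) (by norm_cast)).clm_apply contDiff_const

lemma Smooth.differentiable {f : ℝ × ℝ → ℝ} (hf : Smooth f) : Differentiable ℝ f :=
  ContDiff.differentiable hf (by simp)

lemma pd1_add {f g : ℝ × ℝ → ℝ} (hf : Differentiable ℝ f) (hg : Differentiable ℝ g) :
    pd1 (fun x => f x + g x) = fun x => pd1 f x + pd1 g x := by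
  ext x
  simp [pd1, fderiv_fun_add (hf x) (hg x)]

lemma pd2_add {f g : ℝ × ℝ → ℝ} (hf : Differentiable ℝ f) (hg : Differentiable ℝ g) :
    pd2 (fun x => f x + g x) = fun x => pd2 f x + pd2 g x := by
  ext x
  simp [pd2, fderiv_fun_add (hf x) (hg x)]

lemma pd1_mul {f g : ℝ × ℝ → ℝ} (hf : Differentiable ℝ f) (hg : Differentiable ℝ g) :
    pd1 (fun x => f x * g x) = fun x => f x * pd1 g x + g x * pd1 f x := by
  ext x
  simp [pd1, fderiv_fun_mul (hf x) (hg x)]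

lemma pd2_mul {f g : ℝ × ℝ → ℝ} (hf : Differentiable ℝ f) (hg : Differentiable ℝ g) :
    pd2 (fun x => f x * g x) = fun x => f x * pd2 g x + g x * pd2 f x := by
  ext x
  simp [pd2, fderiv_fun_mul (hf x) (hg x)]

lemma pd2_pd1 {f : ℝ × ℝ → ℝ} (hf : Smooth f) : pd2 (pd1 f) = pd1 (pd2 f) := by
  ext x
  have hd : DifferentiableAt ℝ (fderiv ℝ f) x :=
    ((hf.fderiv_right (m := (⊤ : ℕ∞)) (by norm_cast)).differentiable (by simp)) x
  have hs : IsSymmSndFDerivAt ℝ f x := ContDiff.contDiffAt hf |>.isSymmSndFDerivAt (by simp; norm_cast)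
  have h := hs.eq (0, 1) (1, 0)
  unfold pd1 pd2
  rw [fderiv_clm_apply hd (by fun_prop), fderiv_clm_apply hd (by fun_prop)]
  simpa using h

lemma Per.fderiv {f : ℝ × ℝ → ℝ} (hf : Per f) (v : ℝ × ℝ) :
    Per fun x => fderiv ℝ f x v := by
  have hshift (w : ℝ × ℝ) (h : ∀ x, f (x + w) = f x) (x : ℝ × ℝ) :
      _root_.fderiv ℝ f (x + w) = _root_.fderiv ℝ f x := by
    rw [← fderiv_comp_add_right]
    simp only [h]
  constructor
  · intro x
    have := hshift (2 * π, 0) (fun y => by rw [← hf.1 y, Prod.add_def, add_zero]) x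
    beta_reduce
    rw [← this, Prod.add_def, add_zero]
  · intro x
    have := hshift (0, 2 * π) (fun y => by rw [← hf.2 y, Prod.add_def, add_zero]) x
    beta_reduce
    rw [← this, Prod.add_def, add_zero]

lemma Per.pd1 {f : ℝ × ℝ → ℝ} (hf : Per f) : Per (pd1 f) := hf.fderiv _

lemma Per.pd2 {f : ℝ × ℝ → ℝ} (hf : Per f) : Per (pd2 f) := hf.fderiv _

lemma integrableOn_I2pi {E : Type*} [NormedAddCommGroup E] {g : ℝ → E} (hg : Continuous g) :
    IntegrableOn g I2pi :=
  (hg.integrableOn_Icc (a := 0) (b := 2 * π)).mono_set Ioc_subset_Icc_self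

lemma integrableOn_Q2 {E : Type*} [NormedAddCommGroup E] {f : ℝ × ℝ → E} (hf : Continuous f) :
    IntegrableOn f Q2 :=
  (hf.continuousOn.integrableOn_compact (isCompact_Icc.prod isCompact_Icc)).mono_set
    (prod_mono Ioc_subset_Icc_self Ioc_subset_Icc_self)

lemma measurableSet_Q2 : MeasurableSet Q2 := measurableSet_Ioc.prod measurableSet_Ioc

section

variable {E : Type*} [NormedAddCommGroup E] [NormedSpace ℝ E]

lemma integral_I2pi (g : ℝ → E) : ∫ x in I2pi, g x = ∫ x in (0)..(2 * π), g x :=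
  (intervalIntegral.integral_of_le two_pi_pos.le).symm

lemma integral_Q2 {f : ℝ × ℝ → E} (hf : Continuous f) :
    ∫ x in Q2, f x = ∫ x in I2pi, ∫ y in I2pi, f (x, y) :=
  setIntegral_prod f (integrableOn_Q2 hf)

lemma integral_Q2_symm {f : ℝ × ℝ → E} (hf : Continuous f) :
    ∫ x in Q2, f x = ∫ y in I2pi, ∫ x in I2pi, f (x, y) := by
  rw [integral_Q2 hf]
  apply integral_integral_swap
  rw [Measure.prod_restrict]
  exact integrableOn_Q2 hf

lemma continuous_integral_I2pi {f : ℝ × ℝ → E} (hf : Continuous f) :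
    Continuous fun x => ∫ y in I2pi, f (x, y) := by
  simp only [integral_I2pi]
  exact intervalIntegral.continuous_parametric_intervalIntegral_of_continuous'
    (f := fun x y => f (x, y)) hf _ _

lemma integral_fderiv_fst [CompleteSpace E] {f : ℝ × ℝ → E} (hf : ContDiff ℝ 1 f)
    (hp : ∀ x : ℝ × ℝ, f (x.1 + 2 * π, x.2) = f x) :
    ∫ x in Q2, fderiv ℝ f x (1, 0) = 0 := by
  have hc : Continuous fun x => fderiv ℝ f x (1, 0) :=
    (hf.continuous_fderiv (by simp)).clm_apply continuous_const
  rw [integral_Q2_symm hc]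
  refine (setIntegral_congr_fun measurableSet_Ioc fun y _ => ?_).trans (integral_zero _ _)
  have h : ∀ x : ℝ, HasDerivAt (fun x => f (x, y)) (fderiv ℝ f (x, y) (1, 0)) x := fun x =>
    ((hf.differentiable (by simp)) (x, y)).hasFDerivAt.comp_hasDerivAt x
      ((hasDerivAt_id x).prodMk (hasDerivAt_const x y))
  simp only [integral_I2pi]
  rw [intervalIntegral.integral_eq_sub_of_hasDerivAt (fun x _ => h x)
    ((hc.comp (by fun_prop : Continuous fun x : ℝ => (x, y))).intervalIntegrable _ _)]
  simpa [sub_eq_zero] using hp (0, y)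

lemma integral_fderiv_snd [CompleteSpace E] {f : ℝ × ℝ → E} (hf : ContDiff ℝ 1 f)
    (hp : ∀ x : ℝ × ℝ, f (x.1, x.2 + 2 * π) = f x) :
    ∫ x in Q2, fderiv ℝ f x (0, 1) = 0 := by
  have hc : Continuous fun x => fderiv ℝ f x (0, 1) :=
    (hf.continuous_fderiv (by simp)).clm_apply continuous_const
  rw [integral_Q2 hc]
  refine (setIntegral_congr_fun measurableSet_Ioc fun x _ => ?_).trans (integral_zero _ _)
  have h : ∀ y : ℝ, HasDerivAt (fun y => f (x, y)) (fderiv ℝ f (x, y) (0, 1)) y := fun y =>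
    ((hf.differentiable (by simp)) (x, y)).hasFDerivAt.comp_hasDerivAt y
      ((hasDerivAt_const y x).prodMk (hasDerivAt_id y))
  simp only [integral_I2pi]
  rw [intervalIntegral.integral_eq_sub_of_hasDerivAt (fun y _ => h y)
    ((hc.comp (by fun_prop : Continuous fun y : ℝ => (x, y))).intervalIntegrable _ _)]
  simpa [sub_eq_zero] using hp (x, 0)

end

lemma hasSum_sq_fc1 {g : ℝ → ℂ} (hg : Continuous g) :
    HasSum (fun n => ‖fc1 g n‖ ^ 2) ((2 * π)⁻¹ * ∫ x in I2pi, ‖g x‖ ^ 2) := by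
  have hL2 : MemLp g 2 (volume.restrict (Ioc 0 (2 * π))) := by
    rw [memLp_two_iff_integrable_sq_norm hg.aestronglyMeasurable]
    exact integrableOn_I2pi (by fun_prop)
  have h := hasSum_sq_fourierCoeffOn two_pi_pos hL2
  rw [integral_I2pi]
  convert h using 3 with n
  · congr 1
    rw [fourierCoeffOn_eq_integral, fc1, integral_I2pi, Complex.real_smul]
    congr 1
    · push_cast; simp
    · refine intervalIntegral.integral_congr fun x _ => ?_
      simp only [fourier_coe_apply, smul_eq_mul]
      rw [mul_comm]
      congr 2
      push_cast
      field_simp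
      simp
      ring
  · simp

lemma fcC_eq {f : ℝ × ℝ → ℂ} (hf : Continuous f) (k : ℤ × ℤ) :
    fcC f k = fc1 (fun x => fc1 (fun y => f (x, y)) k.2) k.1 := by
  rw [fcC, integral_Q2 (by fun_prop)]
  simp only [fc1]
  rw [← integral_const_mul, ← integral_const_mul]
  congr 1 with x
  rw [← integral_const_mul, ← integral_const_mul, ← integral_mul_const, ← integral_const_mul]
  congr 1 with y
  rw [mul_add, Complex.exp_add]
  ring

lemma hasSum_sq_fcC {f : ℝ × ℝ → ℂ} (hf : Continuous f) :
    HasSum (fun k => ‖fcC f k‖ ^ 2) (((2 * π) ^ 2)⁻¹ * ∫ x in Q2, ‖f x‖ ^ 2) := by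
  have hG (n : ℤ) : Continuous fun x => fc1 (fun y => f (x, y)) n := by
    unfold fc1
    exact continuous_const.mul (continuous_integral_I2pi
      (f := fun p => f p * cexp (-Complex.I * (n * p.2))) (by fun_prop))
  have hrow (n : ℤ) : HasSum (fun m => ‖fcC f (m, n)‖ ^ 2)
      ((2 * π)⁻¹ * ∫ x in I2pi, ‖fc1 (fun y => f (x, y)) n‖ ^ 2) := by
    simpa only [fcC_eq hf] using hasSum_sq_fc1 (hG n)
  have hpt (x : ℝ) := hasSum_sq_fc1 (g := fun y => f (x, y)) (by fun_prop)
  have hint : Continuous fun x => (2 * π)⁻¹ * ∫ y in I2pi, ‖f (x, y)‖ ^ 2 :=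
    continuous_const.mul (continuous_integral_I2pi (f := fun p => ‖f p‖ ^ 2) (by fun_prop))
  have hcol := hasSum_integral_of_dominated_convergence (μ := volume.restrict I2pi)
    (F := fun (n : ℤ) x => ‖fc1 (fun y => f (x, y)) n‖ ^ 2)
    (f := fun x => (2 * π)⁻¹ * ∫ y in I2pi, ‖f (x, y)‖ ^ 2)
    (fun (n : ℤ) x => ‖fc1 (fun y => f (x, y)) n‖ ^ 2)
    (fun n => ((hG n).norm.pow 2).aestronglyMeasurable)
    (fun n => .of_forall fun x => by simp)
    (.of_forall fun x => (hpt x).summable)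
    (by simp only [(hpt _).tsum_eq]; exact integrableOn_I2pi hint)
    (.of_forall hpt)
  rw [integral_const_mul, ← integral_Q2 (f := fun p => ‖f p‖ ^ 2) (by fun_prop)] at hcol
  have hcol' := hcol.mul_left (2 * π)⁻¹
  have hsum : Summable fun p : ℤ × ℤ => ‖fcC f p.swap‖ ^ 2 := by
    rw [summable_prod_of_nonneg fun _ => by positivity]
    refine ⟨fun n => (hrow n).summable, ?_⟩
    simpa only [Prod.swap, (hrow _).tsum_eq] using hcol'.summable
  have := (hsum.hasSum.prod_fiberwise fun n => hrow n).unique hcol'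
  rw [← (Equiv.prodComm ℤ ℤ).hasSum_iff]
  convert hsum.hasSum using 1
  · rfl
  · rw [this]
    ring

lemma fderiv_ofReal_mul_character {f : ℝ × ℝ → ℝ} (hf : Differentiable ℝ f) (k : ℤ × ℤ)
    (x v : ℝ × ℝ) :
    fderiv ℝ (fun x : ℝ × ℝ => (f x : ℂ) *
        cexp (-Complex.I * ((k.1 : ℂ) * (x.1 : ℂ) + (k.2 : ℂ) * (x.2 : ℂ)))) x v =
      (fderiv ℝ f x v : ℂ) *
          cexp (-Complex.I * ((k.1 : ℂ) * (x.1 : ℂ) + (k.2 : ℂ) * (x.2 : ℂ))) -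
        Complex.I * (k.1 * v.1 + k.2 * v.2) * ((f x : ℂ) *
          cexp (-Complex.I * ((k.1 : ℂ) * (x.1 : ℂ) + (k.2 : ℂ) * (x.2 : ℂ)))) := by
  have h1 : HasFDerivAt (fun x : ℝ × ℝ => (x.1 : ℂ))
      (Complex.ofRealCLM.comp (ContinuousLinearMap.fst ℝ ℝ ℝ)) x :=
    (Complex.ofRealCLM.comp (ContinuousLinearMap.fst ℝ ℝ ℝ)).hasFDerivAt
  have h2 : HasFDerivAt (fun x : ℝ × ℝ => (x.2 : ℂ))
      (Complex.ofRealCLM.comp (ContinuousLinearMap.snd ℝ ℝ ℝ)) x :=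
    (Complex.ofRealCLM.comp (ContinuousLinearMap.snd ℝ ℝ ℝ)).hasFDerivAt
  have hF : HasFDerivAt (fun x => (f x : ℂ)) (Complex.ofRealCLM.comp (fderiv ℝ f x)) x :=
    Complex.ofRealCLM.hasFDerivAt.comp x (hf x).hasFDerivAt
  have h := hF.mul (((h1.const_mul (k.1 : ℂ)).add (h2.const_mul (k.2 : ℂ))).const_mul
    (-Complex.I)).cexp
  refine (congrArg (fun L => L v) h.fderiv).trans ?_
  simp
  ring

lemma contDiff_ofReal_mul_character {f : ℝ × ℝ → ℝ} (hf : Smooth f) (k : ℤ × ℤ) :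
    ContDiff ℝ 1 (fun x : ℝ × ℝ => (f x : ℂ) *
      cexp (-Complex.I * ((k.1 : ℂ) * (x.1 : ℂ) + (k.2 : ℂ) * (x.2 : ℂ)))) := by
  have hf1 : ContDiff ℝ 1 f := hf.of_le (by norm_cast)
  have h0 : ContDiff ℝ 1 (fun x => (f x : ℂ)) := Complex.ofRealCLM.contDiff.comp hf1
  have h1 : ContDiff ℝ 1 (fun x : ℝ × ℝ => (x.1 : ℂ)) := Complex.ofRealCLM.contDiff.comp contDiff_fst
  have h2 : ContDiff ℝ 1 (fun x : ℝ × ℝ => (x.2 : ℂ)) := Complex.ofRealCLM.contDiff.comp contDiff_snd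
  fun_prop

lemma exp_int_mul_two_pi (n : ℤ) : cexp (-Complex.I * (n * (2 * π))) = 1 := by
  rw [Complex.exp_eq_one_iff]
  exact ⟨-n, by push_cast; ring⟩

lemma fc_pd1 {f : ℝ × ℝ → ℝ} (hf : Smooth f) (hp : Per f) (k : ℤ × ℤ) :
    fc (pd1 f) k = Complex.I * k.1 * fc f k := by
  have h := integral_fderiv_fst (contDiff_ofReal_mul_character hf k) (fun x => by
    rw [hp.1 x]
    push_cast
    rw [mul_add (k.1 : ℂ), add_right_comm, mul_add (-Complex.I), Complex.exp_add,
      exp_int_mul_two_pi, mul_one])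
  have c0 : Continuous (pd1 f) := ContDiff.continuous hf.pd1
  have c1 : Continuous f := ContDiff.continuous hf
  simp only [fderiv_ofReal_mul_character hf.differentiable k] at h
  rw [integral_sub, integral_const_mul, sub_eq_zero] at h
  · simp only [fc, fcC]
    unfold pd1
    rw [h]
    push_cast
    ring
  · exact integrableOn_Q2 (f := fun x => (pd1 f x : ℂ) *
      cexp (-Complex.I * ((k.1 : ℂ) * (x.1 : ℂ) + (k.2 : ℂ) * (x.2 : ℂ)))) (by fun_prop)
  · exact integrableOn_Q2 (by fun_prop)

lemma fc_pd2 {f : ℝ × ℝ → ℝ} (hf : Smooth f) (hp : Per f) (k : ℤ × ℤ) :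
    fc (pd2 f) k = Complex.I * k.2 * fc f k := by
  have h := integral_fderiv_snd (contDiff_ofReal_mul_character hf k) (fun x => by
    rw [hp.2 x]
    push_cast
    rw [mul_add (k.2 : ℂ), ← add_assoc, mul_add (-Complex.I) (_ + _), Complex.exp_add,
      exp_int_mul_two_pi, mul_one])
  have c0 : Continuous (pd2 f) := ContDiff.continuous hf.pd2
  have c1 : Continuous f := ContDiff.continuous hf
  simp only [fderiv_ofReal_mul_character hf.differentiable k] at h
  rw [integral_sub, integral_const_mul, sub_eq_zero] at h
  · simp only [fc, fcC]
    unfold pd2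
    rw [h]
    push_cast
    ring
  · exact integrableOn_Q2 (f := fun x => (pd2 f x : ℂ) *
      cexp (-Complex.I * ((k.1 : ℂ) * (x.1 : ℂ) + (k.2 : ℂ) * (x.2 : ℂ)))) (by fun_prop)
  · exact integrableOn_Q2 (by fun_prop)

/-- Squared `L²` norm on the torus. -/
def normSqL2 (f : ℝ × ℝ → ℝ) : ℝ := tintR fun x => f x ^ 2

lemma normSqL2_nonneg (f : ℝ × ℝ → ℝ) : 0 ≤ normSqL2 f :=
  integral_nonneg fun x => sq_nonneg (f x)

lemma hasSum_sq_fc {f : ℝ × ℝ → ℝ} (hf : Smooth f) :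
    HasSum (fun k => ‖fc f k‖ ^ 2) (((2 * π) ^ 2)⁻¹ * normSqL2 f) := by
  have c1 : Continuous f := ContDiff.continuous hf
  simpa [normSqL2, tintR, fc] using hasSum_sq_fcC (f := fun x => (f x : ℂ)) (by fun_prop)

lemma HSq_zero_one {f : ℝ × ℝ → ℝ} (hf : Smooth f) (hp : Per f) :
    HSq 0 1 f = ((2 * π) ^ 2)⁻¹ * (normSqL2 f + normSqL2 (pd2 f)) := by
  rw [mul_add]
  refine HasSum.tsum_eq ?_
  convert (hasSum_sq_fc hf).add (hasSum_sq_fc hf.pd2) using 2 with k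
  rw [fc_pd2 hf hp]
  simp [aw, mul_pow]
  ring

lemma HSq_one_one {f : ℝ × ℝ → ℝ} (hf : Smooth f) (hp : Per f) :
    HSq 1 1 f = ((2 * π) ^ 2)⁻¹ * (normSqL2 f + normSqL2 (pd1 f) + normSqL2 (pd2 f) +
      normSqL2 (pd1 (pd2 f))) := by
  simp only [mul_add]
  refine HasSum.tsum_eq ?_
  convert (((hasSum_sq_fc hf).add (hasSum_sq_fc hf.pd1)).add (hasSum_sq_fc hf.pd2)).add
    (hasSum_sq_fc hf.pd2.pd1) using 2 with k
  rw [fc_pd1 hf.pd2 hp.pd2, fc_pd2 hf hp, fc_pd1 hf hp]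
  simp [aw, mul_pow]
  ring

lemma HSq_one_two {f : ℝ × ℝ → ℝ} (hf : Smooth f) (hp : Per f) :
    HSq 1 2 f = ((2 * π) ^ 2)⁻¹ * (normSqL2 f + normSqL2 (pd1 f) + 2 * normSqL2 (pd2 f) +
      2 * normSqL2 (pd1 (pd2 f)) + normSqL2 (pd2 (pd2 f)) + normSqL2 (pd1 (pd2 (pd2 f)))) := by
  simp only [mul_add, mul_left_comm _ (2 : ℝ)]
  refine HasSum.tsum_eq ?_
  convert (((((hasSum_sq_fc hf).add (hasSum_sq_fc hf.pd1)).add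
    ((hasSum_sq_fc hf.pd2).mul_left 2)).add ((hasSum_sq_fc hf.pd2.pd1).mul_left 2)).add
    (hasSum_sq_fc hf.pd2.pd2)).add (hasSum_sq_fc hf.pd2.pd2.pd1) using 2 with k
  rw [fc_pd1 hf.pd2.pd2 hp.pd2.pd2, fc_pd2 hf.pd2 hp.pd2, fc_pd1 hf.pd2 hp.pd2, fc_pd2 hf hp,
    fc_pd1 hf hp]
  simp [aw, mul_pow]
  ring

lemma HSq_nonneg (s s' : ℝ) (f : ℝ × ℝ → ℝ) : 0 ≤ HSq s s' f :=
  tsum_nonneg fun k => by unfold aw; positivity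

lemma HNV_sq (s s' : ℝ) (u : ℝ × ℝ → ℝ × ℝ) :
    HNV s s' u ^ 2 = HSq s s' (comp1 u) + HSq s s' (comp2 u) :=
  Real.sq_sqrt (add_nonneg (HSq_nonneg _ _ _) (HSq_nonneg _ _ _))

lemma sq_le_integral_sq_add_sq {g g' : ℝ → ℝ} (hg : ∀ x, HasDerivAt g (g' x) x)
    (hg' : Continuous g') {x : ℝ} (hx : x ∈ I2pi) :
    g x ^ 2 ≤ 2 * ∫ y in I2pi, (g y ^ 2 + g' y ^ 2) := by
  have hc : Continuous g := continuous_iff_continuousAt.2 fun x => (hg x).continuousAt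
  set J := ∫ y in I2pi, (g y ^ 2 + g' y ^ 2) with hJ
  have hint : IntegrableOn (fun y => g y ^ 2 + g' y ^ 2) I2pi := integrableOn_I2pi (by fun_prop)
  have hpt : ∀ y ∈ I2pi, g x ^ 2 ≤ g y ^ 2 + J := by
    intro y hy
    have hd : ∀ z, HasDerivAt (fun z => g z ^ 2) (2 * g z * g' z) z := fun z => by
      simpa using (hg z).fun_pow 2
    have hftc := intervalIntegral.integral_eq_sub_of_hasDerivAt (a := y) (b := x)
      (fun z _ => hd z)
      ((by fun_prop : Continuous fun z => 2 * g z * g' z).intervalIntegrable _ _)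
    have hle : ‖∫ z in y..x, 2 * g z * g' z‖ ≤ J := by
      refine intervalIntegral.norm_integral_le_integral_norm_uIoc.trans ?_
      have hsub : uIoc y x ⊆ I2pi := by
        intro z hz
        rcases mem_uIoc.1 hz with h | h
        · exact ⟨hy.1.trans h.1, h.2.trans hx.2⟩
        · exact ⟨hx.1.trans h.1, h.2.trans hy.2⟩
      calc ∫ z in uIoc y x, ‖2 * g z * g' z‖
          ≤ ∫ z in I2pi, ‖2 * g z * g' z‖ :=
            setIntegral_mono_set (integrableOn_I2pi (by fun_prop))
              (.of_forall fun _ => norm_nonneg _) hsub.eventuallyLE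
        _ ≤ J := by
            refine integral_mono (integrableOn_I2pi (by fun_prop)) hint fun z => ?_
            simp only [Real.norm_eq_abs]
            exact abs_le.2 ⟨by nlinarith [sq_nonneg (g z + g' z)],
              by nlinarith [sq_nonneg (g z - g' z)]⟩
    rw [hftc, Real.norm_eq_abs] at hle
    linarith [le_abs_self (g x ^ 2 - g y ^ 2)]
  have hvol : volume.real I2pi = 2 * π := by
    simp [I2pi, Measure.real, pi_pos.le]
  have hmono : ∫ y in I2pi, g x ^ 2 ≤ ∫ y in I2pi, (g y ^ 2 + J) :=
    setIntegral_mono_on (integrableOn_I2pi continuous_const)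
      (integrableOn_I2pi (by fun_prop)) measurableSet_Ioc hpt
  rw [integral_add (integrableOn_I2pi (by fun_prop)) (integrableOn_I2pi continuous_const),
    setIntegral_const, setIntegral_const, hvol, smul_eq_mul, smul_eq_mul] at hmono
  have hle : ∫ y in I2pi, g y ^ 2 ≤ J :=
    integral_mono (integrableOn_I2pi (by fun_prop)) hint fun y => by
      simpa using sq_nonneg (g' y)
  have hJ0 : 0 ≤ J := integral_nonneg fun y => by positivity
  have hπ := pi_gt_three
  nlinarith

lemma sq_le_integral_snd {f : ℝ × ℝ → ℝ} (hf : Smooth f) (x : ℝ) {y : ℝ} (hy : y ∈ I2pi) :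
    f (x, y) ^ 2 ≤ 2 * ∫ z in I2pi, (f (x, z) ^ 2 + pd2 f (x, z) ^ 2) := by
  have c0 : Continuous (pd2 f) := ContDiff.continuous hf.pd2
  exact sq_le_integral_sq_add_sq (g := fun y => f (x, y)) (g' := fun y => pd2 f (x, y))
    (fun y => (hf.differentiable (x, y)).hasFDerivAt.comp_hasDerivAt y
      ((hasDerivAt_const y x).prodMk (hasDerivAt_id y))) (by fun_prop) hy

lemma sq_le_integral_fst {f : ℝ × ℝ → ℝ} (hf : Smooth f) (y : ℝ) {x : ℝ} (hx : x ∈ I2pi) :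
    f (x, y) ^ 2 ≤ 2 * ∫ z in I2pi, (f (z, y) ^ 2 + pd1 f (z, y) ^ 2) := by
  have c0 : Continuous (pd1 f) := ContDiff.continuous hf.pd1
  exact sq_le_integral_sq_add_sq (g := fun x => f (x, y)) (g' := fun x => pd1 f (x, y))
    (fun x => (hf.differentiable (x, y)).hasFDerivAt.comp_hasDerivAt x
      ((hasDerivAt_id x).prodMk (hasDerivAt_const x y))) (by fun_prop) hx

lemma integral_sq_snd_le {f : ℝ × ℝ → ℝ} (hf : Smooth f) {x : ℝ} (hx : x ∈ I2pi) :
    ∫ y in I2pi, f (x, y) ^ 2 ≤ 2 * (normSqL2 f + normSqL2 (pd1 f)) := by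
  have c0 : Continuous f := ContDiff.continuous hf
  have c1 : Continuous (pd1 f) := ContDiff.continuous hf.pd1
  have hc : Continuous fun p : ℝ × ℝ => f p ^ 2 + pd1 f p ^ 2 := by fun_prop
  calc ∫ y in I2pi, f (x, y) ^ 2
      ≤ ∫ y in I2pi, 2 * ∫ z in I2pi, (f (z, y) ^ 2 + pd1 f (z, y) ^ 2) :=
        integral_mono (integrableOn_I2pi (by fun_prop))
          (integrableOn_I2pi (continuous_const.mul (continuous_integral_I2pi
            (f := fun p => f (p.2, p.1) ^ 2 + pd1 f (p.2, p.1) ^ 2) (by fun_prop))))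
          fun y => sq_le_integral_fst hf y hx
    _ = 2 * (normSqL2 f + normSqL2 (pd1 f)) := by
        rw [integral_const_mul, ← integral_Q2_symm hc, integral_add
          (integrableOn_Q2 (by fun_prop)) (integrableOn_Q2 (by fun_prop))]
        rfl

lemma sq_le_normSqL2 {f : ℝ × ℝ → ℝ} (hf : Smooth f) {x : ℝ × ℝ} (hx : x ∈ Q2) :
    f x ^ 2 ≤ 4 * (normSqL2 f + normSqL2 (pd1 f) + normSqL2 (pd2 f) +
      normSqL2 (pd1 (pd2 f))) := by
  have c0 : Continuous f := ContDiff.continuous hf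
  have c1 : Continuous (pd2 f) := ContDiff.continuous hf.pd2
  have h := sq_le_integral_snd hf x.1 hx.2
  rw [integral_add (integrableOn_I2pi (by fun_prop)) (integrableOn_I2pi (by fun_prop))] at h
  have h1 := integral_sq_snd_le hf hx.1
  have h2 := integral_sq_snd_le hf.pd2 hx.1
  linarith

lemma integral_sq_mul_sq_le {f g : ℝ × ℝ → ℝ} (hf : Smooth f) (hg : Smooth g) :
    ∫ x in Q2, (f x * g x) ^ 2 ≤
      4 * (normSqL2 f + normSqL2 (pd1 f)) * (normSqL2 g + normSqL2 (pd2 g)) := by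
  have c0 : Continuous f := ContDiff.continuous hf
  have c1 : Continuous g := ContDiff.continuous hg
  have c2 : Continuous (pd2 g) := ContDiff.continuous hg.pd2
  have hc : Continuous fun p : ℝ × ℝ => g p ^ 2 + pd2 g p ^ 2 := by fun_prop
  have hG := continuous_integral_I2pi hc
  set A := normSqL2 f + normSqL2 (pd1 f)
  rw [integral_Q2 (by fun_prop)]
  calc ∫ x in I2pi, ∫ y in I2pi, (f (x, y) * g (x, y)) ^ 2
      ≤ ∫ x in I2pi, 4 * A * ∫ z in I2pi, (g (x, z) ^ 2 + pd2 g (x, z) ^ 2) := by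
        refine setIntegral_mono_on (integrableOn_I2pi (continuous_integral_I2pi
          (f := fun p => (f p * g p) ^ 2) (by fun_prop)))
          (integrableOn_I2pi (by fun_prop)) measurableSet_Ioc fun x hx => ?_
        set G := ∫ z in I2pi, (g (x, z) ^ 2 + pd2 g (x, z) ^ 2) with hGdef
        have hG0 : 0 ≤ G := integral_nonneg fun y => by positivity
        calc ∫ y in I2pi, (f (x, y) * g (x, y)) ^ 2
            ≤ ∫ y in I2pi, f (x, y) ^ 2 * (2 * G) := by
              refine setIntegral_mono_on (integrableOn_I2pi (by fun_prop))
                (integrableOn_I2pi (by fun_prop)) measurableSet_Ioc fun y hy => ?_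
              rw [mul_pow]
              exact mul_le_mul_of_nonneg_left (sq_le_integral_snd hg x hy) (sq_nonneg _)
          _ = (∫ y in I2pi, f (x, y) ^ 2) * (2 * G) := integral_mul_const _ _
          _ ≤ 2 * A * (2 * G) :=
              mul_le_mul_of_nonneg_right (integral_sq_snd_le hf hx) (by positivity)
          _ = 4 * A * G := by ring
    _ = 4 * A * (normSqL2 g + normSqL2 (pd2 g)) := by
        rw [integral_const_mul, ← integral_Q2 hc, integral_add
          (integrableOn_Q2 (by fun_prop)) (integrableOn_Q2 (by fun_prop))]
        rfl

lemma Smooth.add {f g : ℝ × ℝ → ℝ} (hf : Smooth f) (hg : Smooth g) :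
    Smooth fun x => f x + g x := ContDiff.add hf hg

lemma Smooth.mul {f g : ℝ × ℝ → ℝ} (hf : Smooth f) (hg : Smooth g) :
    Smooth fun x => f x * g x := ContDiff.mul hf hg

lemma Per.add {f g : ℝ × ℝ → ℝ} (hf : Per f) (hg : Per g) : Per fun x => f x + g x :=
  ⟨fun x => by simp only [hf.1 x, hg.1 x], fun x => by simp only [hf.2 x, hg.2 x]⟩

lemma Per.mul {f g : ℝ × ℝ → ℝ} (hf : Per f) (hg : Per g) : Per fun x => f x * g x :=
  ⟨fun x => by simp only [hf.1 x, hg.1 x], fun x => by simp only [hf.2 x, hg.2 x]⟩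

lemma integral_Q2_add {f g : ℝ × ℝ → ℝ} (hf : Continuous f) (hg : Continuous g) :
    ∫ x in Q2, (f x + g x) = (∫ x in Q2, f x) + ∫ x in Q2, g x :=
  integral_add (integrableOn_Q2 hf) (integrableOn_Q2 hg)

lemma integral_pd1 {f : ℝ × ℝ → ℝ} (hf : Smooth f) (hp : Per f) : ∫ x in Q2, pd1 f x = 0 :=
  integral_fderiv_fst (hf.of_le (by norm_cast)) hp.1

lemma integral_pd2 {f : ℝ × ℝ → ℝ} (hf : Smooth f) (hp : Per f) : ∫ x in Q2, pd2 f x = 0 :=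
  integral_fderiv_snd (hf.of_le (by norm_cast)) hp.2

/-- Contribution of one component `U` of `u` and the matching component `w` of `V` to the
integrand of the transport terms, where `u = (a, b)` and `V = (p, q)`. -/
def transportDensity (a b U p q w : ℝ × ℝ → ℝ) (x : ℝ × ℝ) : ℝ :=
  (p x * pd1 U x + q x * pd2 U x) * w x +
    pd2 (fun x => p x * pd1 U x + q x * pd2 U x) x * pd2 w x +
    (a x * pd1 w x + b x * pd2 w x) * w x +
    pd2 (fun x => a x * pd1 w x + b x * pd2 w x) x * pd2 w x

/-- What is left of `transportDensity` after moving total derivatives aside. -/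
def transportRemainder (a b U p q w : ℝ × ℝ → ℝ) (x : ℝ × ℝ) : ℝ :=
  -(U x * pd1 p x * w x) - U x * pd1 w x * p x + q x * pd2 U x * w x -
    U x * pd1 (pd2 p) x * pd2 w x - U x * pd1 (pd2 w) x * pd2 p x +
    pd2 U x * pd2 q x * pd2 w x - pd2 U x * pd1 p x * pd2 w x -
    pd2 U x * pd1 (pd2 w) x * p x + q x * pd2 (pd2 U) x * pd2 w x +
    pd2 a x * pd1 w x * pd2 w x + pd2 b x * pd2 w x * pd2 w x

section

variable {a b U p q w : ℝ × ℝ → ℝ}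

lemma Smooth.transportRemainder (ha : Smooth a) (hb : Smooth b) (hU : Smooth U)
    (hp : Smooth p) (hq : Smooth q) (hw : Smooth w) :
    Smooth (transportRemainder a b U p q w) := by
  have h1 := hU.pd2
  have h2 := hp.pd1
  have h3 := hp.pd2
  have h4 := hw.pd1
  have h5 := hw.pd2
  have h6 := hq.pd2
  have h7 := hp.pd2.pd1
  have h8 := hw.pd2.pd1
  have h9 := hU.pd2.pd2
  have h10 := ha.pd2
  have h11 := hb.pd2
  unfold Smooth Aniso.transportRemainder at *
  fun_prop

lemma transportDensity_eq (ha : Smooth a) (hb : Smooth b) (hU : Smooth U)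
    (hp : Smooth p) (hq : Smooth q) (hw : Smooth w) (hdiv : ∀ x, pd1 a x + pd2 b x = 0)
    (x : ℝ × ℝ) :
    transportDensity a b U p q w x =
      pd1 (fun x => U x * (p x * w x + pd2 p x * pd2 w x) + p x * (pd2 U x * pd2 w x)) x +
        (1 / 2) * (pd1 (fun x => a x * (w x * w x + pd2 w x * pd2 w x)) x +
          pd2 (fun x => b x * (w x * w x + pd2 w x * pd2 w x)) x) +
        transportRemainder a b U p q w x := by
  have da := ha.differentiable
  have db := hb.differentiable
  have dU := hU.differentiable
  have dp := hp.differentiable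
  have dq := hq.differentiable
  have dw := hw.differentiable
  have dU1 := hU.pd1.differentiable
  have dU2 := hU.pd2.differentiable
  have dp2 := hp.pd2.differentiable
  have dw1 := hw.pd1.differentiable
  have dw2 := hw.pd2.differentiable
  have ea : pd1 a x = -pd2 b x := by linarith [hdiv x]
  simp (disch := fun_prop) only [transportDensity, transportRemainder, pd1_add, pd2_add, pd1_mul,
    pd2_mul, pd2_pd1 hU, pd2_pd1 hw, ea]
  ring

lemma integral_transportDensity (ha : Smooth a) (hb : Smooth b) (hU : Smooth U)
    (hp : Smooth p) (hq : Smooth q) (hw : Smooth w) (pa : Per a) (pb : Per b) (pU : Per U)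
    (pp : Per p) (pw : Per w) (hdiv : ∀ x, pd1 a x + pd2 b x = 0) :
    ∫ x in Q2, transportDensity a b U p q w x = ∫ x in Q2, transportRemainder a b U p q w x := by
  have hX := (hU.mul ((hp.mul hw).add (hp.pd2.mul hw.pd2))).add (hp.mul (hU.pd2.mul hw.pd2))
  have hE := (hw.mul hw).add (hw.pd2.mul hw.pd2)
  have hEp := (pw.mul pw).add (pw.pd2.mul pw.pd2)
  have hXi := integral_pd1 hX
    ((pU.mul ((pp.mul pw).add (pp.pd2.mul pw.pd2))).add (pp.mul (pU.pd2.mul pw.pd2)))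
  have hYi := integral_pd1 (ha.mul hE) (pa.mul hEp)
  have hZi := integral_pd2 (hb.mul hE) (pb.mul hEp)
  have cX := ContDiff.continuous hX.pd1
  have cY := ContDiff.continuous (ha.mul hE).pd1
  have cZ := ContDiff.continuous (hb.mul hE).pd2
  have cR := ContDiff.continuous (ha.transportRemainder hb hU hp hq hw)
  simp only [transportDensity_eq ha hb hU hp hq hw hdiv]
  rw [integral_Q2_add (by fun_prop) cR, integral_Q2_add cX (by fun_prop), integral_const_mul,
    integral_Q2_add cY cZ, hXi, hYi, hZi]
  simp

lemma abs_mul_mul_le {ε K s x y : ℝ} (hε : 0 < ε) (hs : |s| ≤ K) :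
    |s * x * y| ≤ ε / 2 * x ^ 2 + K ^ 2 / (2 * ε) * y ^ 2 := by
  have hK : s ^ 2 ≤ K ^ 2 := sq_le_sq' (abs_le.1 hs).1 (abs_le.1 hs).2
  have h1 : |s * x * y| ≤ ε / 2 * x ^ 2 + s ^ 2 / (2 * ε) * y ^ 2 := by
    have key (t : ℝ) (ht : t ^ 2 = s ^ 2) :
        t * x * y ≤ ε / 2 * x ^ 2 + s ^ 2 / (2 * ε) * y ^ 2 := by
      have : ε / 2 * x ^ 2 + s ^ 2 / (2 * ε) * y ^ 2 - t * x * y =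
          (ε * x - t * y) ^ 2 / (2 * ε) := by
        rw [← ht]
        field_simp
        ring
      linarith [show 0 ≤ (ε * x - t * y) ^ 2 / (2 * ε) by positivity]
    exact abs_le'.2 ⟨key s rfl, by simpa [neg_mul] using key (-s) (by ring)⟩
  refine h1.trans ?_
  gcongr

lemma abs_transportRemainder_le {ε K : ℝ} (hε : 0 < ε) {x : ℝ × ℝ} (hU : |U x| ≤ K)
    (hU2 : |pd2 U x| ≤ K) (ha2 : |pd2 a x| ≤ K) (hb2 : |pd2 b x| ≤ K) :
    |transportRemainder a b U p q w x| ≤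
      ε * (pd1 p x ^ 2 + pd1 w x ^ 2 + pd1 (pd2 p) x ^ 2 + pd1 (pd2 w) x ^ 2) +
      (2 + K ^ 2 + 2 * K ^ 2 / ε) *
        (p x ^ 2 + q x ^ 2 + w x ^ 2 + pd2 p x ^ 2 + pd2 q x ^ 2 + pd2 w x ^ 2) +
      (pd2 (pd2 U) x * q x) ^ 2 := by
  have t1 := abs_le.1 (abs_mul_mul_le (x := pd1 p x) (y := w x) hε hU)
  have t2 := abs_le.1 (abs_mul_mul_le (x := pd1 w x) (y := p x) hε hU)
  have t3 := abs_le.1 (abs_mul_mul_le (x := q x) (y := w x) one_pos hU2)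
  have t4 := abs_le.1 (abs_mul_mul_le (x := pd1 (pd2 p) x) (y := pd2 w x) hε hU)
  have t5 := abs_le.1 (abs_mul_mul_le (x := pd1 (pd2 w) x) (y := pd2 p x) hε hU)
  have t6 := abs_le.1 (abs_mul_mul_le (x := pd2 q x) (y := pd2 w x) one_pos hU2)
  have t7 := abs_le.1 (abs_mul_mul_le (x := pd1 p x) (y := pd2 w x) hε hU2)
  have t8 := abs_le.1 (abs_mul_mul_le (x := pd1 (pd2 w) x) (y := p x) hε hU2)
  have t9 := abs_le.1 (abs_mul_mul_le (s := 1) (K := 1)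
    (x := pd2 (pd2 U) x * q x) (y := pd2 w x) one_pos (by simp))
  have t10 := abs_le.1 (abs_mul_mul_le (x := pd1 w x) (y := pd2 w x) hε ha2)
  have t11 := abs_le.1 (abs_mul_mul_le (x := pd2 w x) (y := pd2 w x) one_pos hb2)
  have e1 : K ^ 2 / (2 * ε) = K ^ 2 / ε / 2 := by field_simp
  have e2 : 2 * K ^ 2 / ε = 2 * (K ^ 2 / ε) := by ring
  rw [e2]
  rw [e1] at t1 t2 t4 t5 t7 t8 t10
  have hL : 0 ≤ K ^ 2 / ε := by positivity
  generalize K ^ 2 / ε = L at *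
  have hw0 := mul_nonneg hL (sq_nonneg (w x))
  have hp0 := mul_nonneg hL (sq_nonneg (p x))
  have hq0 := mul_nonneg hL (sq_nonneg (q x))
  have hw2 := mul_nonneg hL (sq_nonneg (pd2 w x))
  have hp2 := mul_nonneg hL (sq_nonneg (pd2 p x))
  have hq2 := mul_nonneg hL (sq_nonneg (pd2 q x))
  have kw0 := mul_nonneg (sq_nonneg K) (sq_nonneg (w x))
  have kp0 := mul_nonneg (sq_nonneg K) (sq_nonneg (p x))
  have kq0 := mul_nonneg (sq_nonneg K) (sq_nonneg (q x))
  have kw2 := mul_nonneg (sq_nonneg K) (sq_nonneg (pd2 w x))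
  have kp2 := mul_nonneg (sq_nonneg K) (sq_nonneg (pd2 p x))
  have kq2 := mul_nonneg (sq_nonneg K) (sq_nonneg (pd2 q x))
  have s1 := sq_nonneg (w x)
  have s2 := sq_nonneg (p x)
  have s3 := sq_nonneg (q x)
  have s4 := sq_nonneg (pd2 w x)
  have s5 := sq_nonneg (pd2 p x)
  have s6 := sq_nonneg (pd2 q x)
  have s7 := sq_nonneg (pd2 (pd2 U) x * q x)
  have r1 := mul_nonneg hε.le (sq_nonneg (pd1 w x))
  have r2 := mul_nonneg hε.le (sq_nonneg (pd1 p x))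
  have r3 := mul_nonneg hε.le (sq_nonneg (pd1 (pd2 w) x))
  have r4 := mul_nonneg hε.le (sq_nonneg (pd1 (pd2 p) x))
  unfold transportRemainder
  rw [abs_le]
  constructor <;> linarith

lemma abs_integral_transportDensity_le {ε K : ℝ} (hε : 0 < ε)
    (ha : Smooth a) (hb : Smooth b) (hU : Smooth U)
    (hp : Smooth p) (hq : Smooth q) (hw : Smooth w) (pa : Per a) (pb : Per b) (pU : Per U)
    (pp : Per p) (pw : Per w) (hdiv : ∀ x, pd1 a x + pd2 b x = 0)
    (kU : ∀ x ∈ Q2, |U x| ≤ K) (kU2 : ∀ x ∈ Q2, |pd2 U x| ≤ K)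
    (ka : ∀ x ∈ Q2, |pd2 a x| ≤ K) (kb : ∀ x ∈ Q2, |pd2 b x| ≤ K) :
    |∫ x in Q2, transportDensity a b U p q w x| ≤
      ε * (normSqL2 (pd1 p) + normSqL2 (pd1 w) + normSqL2 (pd1 (pd2 p)) +
        normSqL2 (pd1 (pd2 w))) +
      (2 + K ^ 2 + 2 * K ^ 2 / ε) * (normSqL2 p + normSqL2 q + normSqL2 w + normSqL2 (pd2 p) +
        normSqL2 (pd2 q) + normSqL2 (pd2 w)) +
      4 * (normSqL2 (pd2 (pd2 U)) + normSqL2 (pd1 (pd2 (pd2 U)))) *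
        (normSqL2 q + normSqL2 (pd2 q)) := by
  have cp := ContDiff.continuous hp
  have cq := ContDiff.continuous hq
  have cw := ContDiff.continuous hw
  have cp1 := ContDiff.continuous hp.pd1
  have cw1 := ContDiff.continuous hw.pd1
  have cp2 := ContDiff.continuous hp.pd2
  have cq2 := ContDiff.continuous hq.pd2
  have cw2 := ContDiff.continuous hw.pd2
  have cp12 := ContDiff.continuous hp.pd2.pd1
  have cw12 := ContDiff.continuous hw.pd2.pd1
  have cU22 := ContDiff.continuous hU.pd2.pd2
  rw [integral_transportDensity ha hb hU hp hq hw pa pb pU pp pw hdiv]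
  refine abs_integral_le_integral_abs.trans ?_
  refine (setIntegral_mono_on (integrableOn_Q2
    (ContDiff.continuous (ha.transportRemainder hb hU hp hq hw)).abs)
    (integrableOn_Q2 (by fun_prop)) measurableSet_Q2 fun x hx =>
      abs_transportRemainder_le hε (kU x hx) (kU2 x hx) (ka x hx) (kb x hx)).trans ?_
  refine le_trans (le_of_eq ?_) (add_le_add_right (integral_sq_mul_sq_le hU.pd2.pd2 hq) _)
  simp (disch := fun_prop) only [integral_Q2_add, integral_const_mul, normSqL2, tintR]

end

lemma abs_le_of_HSq_one_two {f : ℝ × ℝ → ℝ} (hf : Smooth f) (hp : Per f) {x : ℝ × ℝ}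
    (hx : x ∈ Q2) {H : ℝ} (hH : HSq 1 2 f ≤ H) :
    |f x| ≤ Real.sqrt (4 * ((2 * π) ^ 2 * H)) ∧ |pd2 f x| ≤ Real.sqrt (4 * ((2 * π) ^ 2 * H)) := by
  have hπ : (0 : ℝ) < (2 * π) ^ 2 := by positivity
  have h : (2 * π) ^ 2 * HSq 1 2 f ≤ (2 * π) ^ 2 * H := by gcongr
  rw [HSq_one_two hf hp, mul_inv_cancel_left₀ hπ.ne'] at h
  have n0 := normSqL2_nonneg f
  have n1 := normSqL2_nonneg (pd1 f)
  have n2 := normSqL2_nonneg (pd2 f)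
  have n3 := normSqL2_nonneg (pd1 (pd2 f))
  have n4 := normSqL2_nonneg (pd2 (pd2 f))
  have n5 := normSqL2_nonneg (pd1 (pd2 (pd2 f)))
  exact ⟨Real.abs_le_sqrt (by linarith [sq_le_normSqL2 hf hx]),
    Real.abs_le_sqrt (by linarith [sq_le_normSqL2 hf.pd2 hx])⟩

lemma sum_ipV_eq {u V : ℝ × ℝ → ℝ × ℝ} (sa : Smooth (comp1 u)) (sb : Smooth (comp2 u))
    (sp : Smooth (comp1 V)) (sq : Smooth (comp2 V)) :
    ipV (advect V u) V + ipV (pd2V (advect V u)) (pd2V V) +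
      ipV (advect u V) V + ipV (pd2V (advect u V)) (pd2V V) =
      (∫ x in Q2, transportDensity (comp1 u) (comp2 u) (comp1 u) (comp1 V) (comp2 V) (comp1 V) x) +
      ∫ x in Q2, transportDensity (comp1 u) (comp2 u) (comp2 u) (comp1 V) (comp2 V) (comp2 V) x := by
  have adv {a b f : ℝ × ℝ → ℝ} (ha : Smooth a) (hb : Smooth b) (hf : Smooth f) :
      Smooth fun x => a x * pd1 f x + b x * pd2 f x := (ha.mul hf.pd1).add (hb.mul hf.pd2)
  have c1 := ContDiff.continuous (((adv sp sq sa).mul sp).add ((adv sp sq sb).mul sq))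
  have c2 := ContDiff.continuous
    (((adv sp sq sa).pd2.mul sp.pd2).add ((adv sp sq sb).pd2.mul sq.pd2))
  have c3 := ContDiff.continuous (((adv sa sb sp).mul sp).add ((adv sa sb sq).mul sq))
  have c4 := ContDiff.continuous
    (((adv sa sb sp).pd2.mul sp.pd2).add ((adv sa sb sq).pd2.mul sq.pd2))
  have j {f w : ℝ × ℝ → ℝ} (hf : Smooth f) (hw : Smooth w) :
      Continuous (transportDensity (comp1 u) (comp2 u) f (comp1 V) (comp2 V) w) :=
    ContDiff.continuous (((((adv sp sq hf).mul hw).add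
      ((adv sp sq hf).pd2.mul hw.pd2)).add ((adv sa sb hw).mul hw)).add
      ((adv sa sb hw).pd2.mul hw.pd2))
  rw [← integral_Q2_add (j sa sp) (j sb sq)]
  have hsum {F G H K : ℝ × ℝ → ℝ} (cF : Continuous F) (cG : Continuous G) (cH : Continuous H)
      (cK : Continuous K) : (∫ x in Q2, F x) + (∫ x in Q2, G x) + (∫ x in Q2, H x) +
        (∫ x in Q2, K x) = ∫ x in Q2, (F x + G x + H x + K x) := by
    simp (disch := fun_prop) only [integral_Q2_add]
  refine (hsum c1 c2 c3 c4).trans ?_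
  congr 1 with x
  simp only [transportDensity]
  ring

/-- `H^{0,1}`-inner product estimate for the transport terms. -/
theorem H01_transport_estimate (α : ℝ) (hα : 0 < α) :
    ∃ C > 0, ∀ u V : ℝ × ℝ → ℝ × ℝ,
      SmoothV u → PerV u → DivFree u →
      SmoothV V → PerV V → DivFree V →
      |ipV (advect V u) V + ipV (pd2V (advect V u)) (pd2V V) +
          ipV (advect u V) V + ipV (pd2V (advect u V)) (pd2V V)| ≤
        α * HNV 1 1 V ^ 2 + C * (1 + HNV 1 2 u ^ 2) * HNV 0 1 V ^ 2 := by
  set ε := α / (4 * (2 * π) ^ 2) with hεdef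
  have hπ : (0 : ℝ) < (2 * π) ^ 2 := by positivity
  have hε : 0 < ε := by positivity
  refine ⟨(2 * π) ^ 2 * (8 + (24 + 32 / ε) * (2 * π) ^ 2), by positivity, ?_⟩
  intro u V hu pu du hV pV dV
  have sa : Smooth (comp1 u) := contDiff_fst.comp hu
  have sb : Smooth (comp2 u) := contDiff_snd.comp hu
  have sp : Smooth (comp1 V) := contDiff_fst.comp hV
  have sq : Smooth (comp2 V) := contDiff_snd.comp hV
  have pa : Per (comp1 u) := pu.1
  have pb : Per (comp2 u) := pu.2
  have pp : Per (comp1 V) := pV.1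
  have pq : Per (comp2 V) := pV.2
  have hsplit : ipV (advect V u) V + ipV (pd2V (advect V u)) (pd2V V) +
      ipV (advect u V) V + ipV (pd2V (advect u V)) (pd2V V) =
      (∫ x in Q2, transportDensity (comp1 u) (comp2 u) (comp1 u) (comp1 V) (comp2 V) (comp1 V) x) +
      ∫ x in Q2, transportDensity (comp1 u) (comp2 u) (comp2 u) (comp1 V) (comp2 V) (comp2 V) x :=
    sum_ipV_eq sa sb sp sq
  have ha0 := HSq_nonneg 1 2 (comp1 u)
  have hb0 := HSq_nonneg 1 2 (comp2 u)
  have hH := HNV_sq 1 2 u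
  have hHnn := sq_nonneg (HNV 1 2 u)
  set H := HNV 1 2 u ^ 2
  have ka {x : ℝ × ℝ} (hx : x ∈ Q2) := abs_le_of_HSq_one_two sa pa hx (H := H) (by linarith)
  have kb {x : ℝ × ℝ} (hx : x ∈ Q2) := abs_le_of_HSq_one_two sb pb hx (H := H) (by linarith)
  have A := abs_integral_transportDensity_le hε sa sb sa sp sq sp pa pb pa pp pp du
    (fun x hx => (ka hx).1) (fun x hx => (ka hx).2) (fun x hx => (ka hx).2) (fun x hx => (kb hx).2)
  have B := abs_integral_transportDensity_le hε sa sb sb sp sq sq pa pb pb pp pq du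
    (fun x hx => (kb hx).1) (fun x hx => (kb hx).2) (fun x hx => (ka hx).2) (fun x hx => (kb hx).2)
  rw [Real.sq_sqrt (by positivity)] at A B
  set X := (2 * π) ^ 2 * H with hX
  have hX0 : 0 ≤ X := by positivity
  set W := normSqL2 (comp1 V) + normSqL2 (pd2 (comp1 V)) +
    (normSqL2 (comp2 V) + normSqL2 (pd2 (comp2 V))) with hW
  set Z := normSqL2 (comp1 V) + normSqL2 (pd1 (comp1 V)) + normSqL2 (pd2 (comp1 V)) +
    normSqL2 (pd1 (pd2 (comp1 V))) + (normSqL2 (comp2 V) + normSqL2 (pd1 (comp2 V)) +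
    normSqL2 (pd2 (comp2 V)) + normSqL2 (pd1 (pd2 (comp2 V)))) with hZ
  have hHX : X = normSqL2 (comp1 u) + normSqL2 (pd1 (comp1 u)) + 2 * normSqL2 (pd2 (comp1 u)) +
      2 * normSqL2 (pd1 (pd2 (comp1 u))) + normSqL2 (pd2 (pd2 (comp1 u))) +
      normSqL2 (pd1 (pd2 (pd2 (comp1 u)))) + (normSqL2 (comp2 u) + normSqL2 (pd1 (comp2 u)) +
      2 * normSqL2 (pd2 (comp2 u)) + 2 * normSqL2 (pd1 (pd2 (comp2 u))) +
      normSqL2 (pd2 (pd2 (comp2 u))) + normSqL2 (pd1 (pd2 (pd2 (comp2 u))))) := by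
    rw [hX, hH, HSq_one_two sa pa, HSq_one_two sb pb, ← mul_add, mul_inv_cancel_left₀ hπ.ne']
  have nn (f : ℝ × ℝ → ℝ) := normSqL2_nonneg f
  have na := nn (comp1 u)
  have na1 := nn (pd1 (comp1 u))
  have na2 := nn (pd2 (comp1 u))
  have na12 := nn (pd1 (pd2 (comp1 u)))
  have na22 := nn (pd2 (pd2 (comp1 u)))
  have na122 := nn (pd1 (pd2 (pd2 (comp1 u))))
  have nb := nn (comp2 u)
  have nb1 := nn (pd1 (comp2 u))
  have nb2 := nn (pd2 (comp2 u))
  have nb12 := nn (pd1 (pd2 (comp2 u)))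
  have nb22 := nn (pd2 (pd2 (comp2 u)))
  have nb122 := nn (pd1 (pd2 (pd2 (comp2 u))))
  have np := nn (comp1 V)
  have np1 := nn (pd1 (comp1 V))
  have np2 := nn (pd2 (comp1 V))
  have np12 := nn (pd1 (pd2 (comp1 V)))
  have nq := nn (comp2 V)
  have nq1 := nn (pd1 (comp2 V))
  have nq2 := nn (pd2 (comp2 V))
  have nq12 := nn (pd1 (pd2 (comp2 V)))
  have hW0 : 0 ≤ W := by positivity
  have hD : 0 ≤ 2 + 4 * X + 2 * (4 * X) / ε := by positivity
  have collect {E F M N : ℝ} (hE : E ≤ 2 * Z) (hF : F ≤ 2 * W) (hM : M ≤ X) (hN0 : 0 ≤ N)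
      (hN : N ≤ W) : ε * E + (2 + 4 * X + 2 * (4 * X) / ε) * F + 4 * M * N ≤
        ε * (2 * Z) + (2 + 4 * X + 2 * (4 * X) / ε) * (2 * W) + 4 * X * W := by
    gcongr
  have A' := A.trans (collect (by linarith) (by linarith) (by linarith) (by linarith)
    (by linarith))
  have B' := B.trans (collect (by linarith) (by linarith) (by linarith) (by linarith)
    (by linarith))
  have hcoef : 8 + X * (24 + 32 / ε) ≤ (8 + (24 + 32 / ε) * (2 * π) ^ 2) * (1 + H) := by
    have : 0 ≤ 8 * H + (24 + 32 / ε) * (2 * π) ^ 2 := by positivity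
    linear_combination this + (24 + 32 / ε) * hX
  rw [hsplit]
  calc _ ≤ _ := abs_add_le _ _
    _ ≤ _ := add_le_add A' B'
    _ = 4 * ε * Z + (8 + X * (24 + 32 / ε)) * W := by ring
    _ ≤ 4 * ε * Z + (8 + (24 + 32 / ε) * (2 * π) ^ 2) * (1 + H) * W := by gcongr
    _ = _ := by
      rw [HNV_sq 1 1, HNV_sq 0 1, HSq_one_one sp pp, HSq_one_one sq pq, HSq_zero_one sp pp,
        HSq_zero_one sq pq, ← mul_add, ← mul_add, ← hZ, ← hW, hεdef]
      field_simp

end Aniso
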